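/- Let d ≥ 2, μ ≥ 0, λ > 0, and let v be the Uvarov modification ⟨v,p⟩ = ⟨u_μ,p⟩ + λ p(0) of the ball moment functional. Then, uniformly for x in compact subsets of {x ∈ ℝ^d : 0 < ‖x‖ < 1}, lim_{n→∞} K_n(v;x,x) / C(n+d, d) = (1/√π) · ( Γ(μ+1/2) Γ((d+1)/2) / Γ(μ+(d+1)/2) ) · (1−‖x‖²)^{−μ}, where C(n+d,d) is the binomial coefficient. -/

import Mathlib

open MvPolynomial Matrix

/-- The index set for monomials of total degree `n` in `d` variables:
multi-indices (exponent tuples) summing to `n`. Its cardinality is `r_n^d = C(n+d-1,n)`. -/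
abbrev Idx (d n : ℕ) : Type := {ν : Fin d → ℕ // ν ∈ Finset.Nat.antidiagonalTuple d n}

/-- The monomial `x^ν` associated with a multi-index `ν` of total degree `n`;
the family `fun α : Idx d n => monIdx α` is the canonical vector `𝕏_n`. -/
noncomputable def monIdx {d n : ℕ} (α : Idx d n) : MvPolynomial (Fin d) ℝ :=
  MvPolynomial.monomial (Finsupp.equivFunOnFinite.symm α.1) 1

/-- A polynomial system (PS): a sequence of vectors `ℙ_n` of size `r_n^d` whose
entries are polynomials of total degree `n`, the entries of `ℙ_0,…,ℙ_n` forming a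
basis of the polynomials of total degree at most `n`. -/
structure PolySystem (d : ℕ) where
  vec : (n : ℕ) → Idx d n → MvPolynomial (Fin d) ℝ
  degree_eq : ∀ n α, (vec n α).totalDegree = n
  indep : LinearIndependent ℝ (fun p : (Σ n : ℕ, Idx d n) => vec p.1 p.2)
  spans : ∀ (n : ℕ) (p : MvPolynomial (Fin d) ℝ), p.totalDegree ≤ n →
    p ∈ Submodule.span ℝ {q | ∃ m ≤ n, ∃ α : Idx d m, q = vec m α}

/-- `{ℙ_n}` is an orthogonal polynomial system (OPS) with respect to the moment
functional `u` : `⟨u, 𝕏_m ℙ_n^t⟩ = 0` for `m < n` and `⟨u, 𝕏_n ℙ_n^t⟩` nonsingular. -/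
def IsOPS {d : ℕ} (u : MvPolynomial (Fin d) ℝ →ₗ[ℝ] ℝ) (P : PolySystem d) : Prop :=
  (∀ m n : ℕ, m < n → ∀ (α : Idx d m) (β : Idx d n), u (monIdx α * P.vec n β) = 0) ∧
  (∀ n : ℕ, IsUnit (Matrix.of fun α β : Idx d n => u (monIdx α * P.vec n β)).det)

/-- `u` is quasi-definite iff it admits an OPS. -/
def QuasiDefinite {d : ℕ} (u : MvPolynomial (Fin d) ℝ →ₗ[ℝ] ℝ) : Prop :=
  ∃ P : PolySystem d, IsOPS u P

/-- `H_n = ⟨u, ℙ_n ℙ_n^t⟩`. -/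
noncomputable def Hmat {d : ℕ} (u : MvPolynomial (Fin d) ℝ →ₗ[ℝ] ℝ) (P : PolySystem d)
    (n : ℕ) : Matrix (Idx d n) (Idx d n) ℝ :=
  Matrix.of fun α β => u (P.vec n α * P.vec n β)

/-- `P_m(u;x,y) = ℙ_m(x)^t H_m⁻¹ ℙ_m(y)`. -/
noncomputable def kerP {d : ℕ} (u : MvPolynomial (Fin d) ℝ →ₗ[ℝ] ℝ) (P : PolySystem d)
    (m : ℕ) (x y : Fin d → ℝ) : ℝ :=
  ∑ α, ∑ β, eval x (P.vec m α) * (Hmat u P m)⁻¹ α β * eval y (P.vec m β)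

/-- `kerLT u P n = K_{n-1}(u;·,·) = Σ_{m<n} P_m(u;·,·)`, so that `kerLT u P 0 = K_{-1} = 0`. -/
noncomputable def kerLT {d : ℕ} (u : MvPolynomial (Fin d) ℝ →ₗ[ℝ] ℝ) (P : PolySystem d)
    (n : ℕ) (x y : Fin d → ℝ) : ℝ :=
  ∑ m ∈ Finset.range n, kerP u P m x y

/-- `𝖯_n(ξ) = (ℙ_n(ξ_1)|⋯|ℙ_n(ξ_N))`. -/
noncomputable def Pmat {d N : ℕ} (P : PolySystem d) (ξ : Fin N → (Fin d → ℝ)) (n : ℕ) :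
    Matrix (Idx d n) (Fin N) ℝ :=
  Matrix.of fun α i => eval (ξ i) (P.vec n α)

/-- `Kmat u P ξ n = 𝒦_{n-1} = (K_{n-1}(u;ξ_i,ξ_j))_{i,j}`, with `𝒦_{-1} = 0`. -/
noncomputable def Kmat {d N : ℕ} (u : MvPolynomial (Fin d) ℝ →ₗ[ℝ] ℝ) (P : PolySystem d)
    (ξ : Fin N → (Fin d → ℝ)) (n : ℕ) : Matrix (Fin N) (Fin N) ℝ :=
  Matrix.of fun i j => kerLT u P n (ξ i) (ξ j)

/-- `Kvec u P ξ n x = 𝖪_{n-1}(ξ,x) = (K_{n-1}(u;ξ_1,x),…,K_{n-1}(u;ξ_N,x))^t`, with `𝖪_{-1}=0`. -/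
noncomputable def Kvec {d N : ℕ} (u : MvPolynomial (Fin d) ℝ →ₗ[ℝ] ℝ) (P : PolySystem d)
    (ξ : Fin N → (Fin d → ℝ)) (n : ℕ) (x : Fin d → ℝ) : Fin N → ℝ :=
  fun i => kerLT u P n (ξ i) x

/-- A PS is monic if the degree-`n` homogeneous part of the entry of `ℙ_n` indexed
by `α` is exactly the monomial `x^α`. -/
def PolySystem.IsMonic {d : ℕ} (P : PolySystem d) : Prop :=
  ∀ (n : ℕ) (α : Idx d n) (ν : Fin d →₀ ℕ), (ν.sum fun _ e => e) = n →
    MvPolynomial.coeff ν (P.vec n α) = if ν = Finsupp.equivFunOnFinite.symm α.1 then 1 else 0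

/-- Multiplication of a real matrix times a vector of polynomials. -/
noncomputable def matVec {d : ℕ} {a b : Type} [Fintype b] (M : Matrix a b ℝ)
    (w : b → MvPolynomial (Fin d) ℝ) (i : a) : MvPolynomial (Fin d) ℝ :=
  ∑ j, M i j • w j

/-- The matrix `L_{n,i}` determined by `x_i 𝕏_n = L_{n,i} 𝕏_{n+1}`. -/
noncomputable def Lmat (d n : ℕ) (i : Fin d) : Matrix (Idx d n) (Idx d (n + 1)) ℝ :=
  Matrix.of fun α β => if β.1 = (fun j => α.1 j + if j = i then 1 else 0) then 1 else 0

/-- The unique multi-index of degree 0. -/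
def zeroIdx {d : ℕ} : Idx d 0 :=
  ⟨fun _ => 0, by simp [Finset.Nat.mem_antidiagonalTuple]⟩

/-- The degree-2 multi-index `e_i + e_j`. -/
def e2 {d : ℕ} (i j : Fin d) : Idx d 2 :=
  ⟨fun k => (if k = i then 1 else 0) + (if k = j then 1 else 0), by
    simp [Finset.Nat.mem_antidiagonalTuple, Finset.sum_add_distrib]⟩

/-- `A_{h,2} = Σ_{1≤i≤j≤d} a^{(2)}_{ij} L_{h,j} L_{h+1,i}`. -/
noncomputable def Amat2 {d : ℕ} (a2 : Idx d 2 → ℝ) (h : ℕ) :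
    Matrix (Idx d h) (Idx d (h + 2)) ℝ :=
  ∑ i : Fin d, ∑ j : Fin d,
    if i ≤ j then a2 (e2 i j) • (Lmat d h j * Lmat d (h + 1) i) else 0

/-- The polynomial `λ(x) = a_2·𝕏_2 + a_1·𝕏_1 + a_0`. -/
noncomputable def lamPoly {d : ℕ} (a2 : Idx d 2 → ℝ) (a1 : Idx d 1 → ℝ) (a0 : ℝ) :
    MvPolynomial (Fin d) ℝ :=
  (∑ α : Idx d 2, a2 α • monIdx α) + (∑ α : Idx d 1, a1 α • monIdx α) + MvPolynomial.C a0

open MeasureTheory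

/-- Generalized binomial coefficient `C(a,k) = a(a-1)⋯(a-k+1)/k!` for real `a`. -/
noncomputable def genBinom (a : ℝ) (k : ℕ) : ℝ :=
  (∏ j ∈ Finset.range k, (a - j)) / (Nat.factorial k)

/-- The Pochhammer symbol `(a)_m = a(a+1)⋯(a+m-1)`. -/
noncomputable def poch (a : ℝ) (m : ℕ) : ℝ := (ascPochhammer ℝ m).eval a

/-- The classical Jacobi polynomial `P_n^{(α,β)}` (Szegő's normalization), as a
univariate real polynomial:
`P_n^{(α,β)}(t) = Σ_{s=0}^n C(n+α, n-s) C(n+β, s) ((t-1)/2)^s ((t+1)/2)^{n-s}`. -/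
noncomputable def jacobiPoly (α β : ℝ) (n : ℕ) : Polynomial ℝ :=
  ∑ s ∈ Finset.range (n + 1),
    Polynomial.C (genBinom (n + α) (n - s) * genBinom (n + β) s * (1 / 2) ^ n) *
      (Polynomial.X - 1) ^ s * (Polynomial.X + 1) ^ (n - s)

/-- Evaluation of the Jacobi polynomial at a real point. -/
noncomputable def jacobiP (α β : ℝ) (n : ℕ) (t : ℝ) : ℝ := (jacobiPoly α β n).eval t

/-- The normalizing constant `h_{j,n}(μ)` for the orthonormal ball polynomials. -/
noncomputable def hjn (d : ℕ) (μ : ℝ) (j n : ℕ) : ℝ :=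
  Real.sqrt ((poch (μ + 1 / 2) j * poch ((d : ℝ) / 2) (n - j) *
      ((n : ℝ) - (j : ℝ) + μ + ((d : ℝ) - 1) / 2)) /
    ((Nat.factorial j : ℝ) * poch (μ + ((d : ℝ) + 1) / 2) (n - j) *
      ((n : ℝ) + μ + ((d : ℝ) - 1) / 2)))

/-- The Laplace operator on polynomials, `Δ = Σ_i ∂²/∂x_i²`. -/
noncomputable def mvLaplacian (d : ℕ) :
    MvPolynomial (Fin d) ℝ →ₗ[ℝ] MvPolynomial (Fin d) ℝ :=
  ∑ i : Fin d, ((MvPolynomial.pderiv i).toLinearMap ∘ₗ (MvPolynomial.pderiv i).toLinearMap)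

/-- `p` is a harmonic polynomial, homogeneous of degree `m`. -/
def IsHarmonicHomogeneous {d : ℕ} (p : MvPolynomial (Fin d) ℝ) (m : ℕ) : Prop :=
  p.IsHomogeneous m ∧ mvLaplacian d p = 0

/-- `σ_m = dim ℋ_m^d`, the dimension of the space of harmonic polynomials in `d`
variables homogeneous of degree `m`. -/
noncomputable def sigmaH (d m : ℕ) : ℕ :=
  Module.finrank ℝ
    ↥((MvPolynomial.homogeneousSubmodule (Fin d) ℝ m) ⊓ LinearMap.ker (mvLaplacian d))

/-- The closed unit ball in `ℝ^d`. -/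
def ballSet (d : ℕ) : Set (Fin d → ℝ) := {x | ∑ i, x i ^ 2 ≤ 1}

/-- The normalizing constant `ω_μ = Γ(μ+(d+1)/2)/(π^{d/2}Γ(μ+1/2))`. -/
noncomputable def omegaMu (d : ℕ) (μ : ℝ) : ℝ :=
  Real.Gamma (μ + ((d : ℝ) + 1) / 2) /
    (Real.pi ^ ((d : ℝ) / 2) * Real.Gamma (μ + 1 / 2))

/-- `u` is the classical ball moment functional
`⟨u_μ, p⟩ = ω_μ ∫_{𝔹^d} p(x)(1-‖x‖²)^{μ-1/2} dx`. -/
def IsBallFunctional (d : ℕ) (μ : ℝ) (u : MvPolynomial (Fin d) ℝ →ₗ[ℝ] ℝ) : Prop :=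
  ∀ p : MvPolynomial (Fin d) ℝ,
    u p = omegaMu d μ *
      ∫ x in ballSet d, (eval x p) * (1 - ∑ i, x i ^ 2) ^ (μ - 1 / 2 : ℝ)

/-- The orthonormal ball polynomial
`P^n_{j,·}(x;μ) = h_{j,n}(μ)⁻¹ P_j^{(μ-1/2,n-2j+(d-2)/2)}(2‖x‖²-1) Y(x)`,
evaluated at `x`, for a harmonic polynomial `Y` homogeneous of degree `n-2j`. -/
noncomputable def ballPval (d : ℕ) (μ : ℝ) (n j : ℕ) (Y : MvPolynomial (Fin d) ℝ)
    (x : Fin d → ℝ) : ℝ :=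
  (hjn d μ j n)⁻¹ *
    jacobiP (μ - 1 / 2) ((n : ℝ) - 2 * (j : ℝ) + ((d : ℝ) - 2) / 2) j
      (2 * (∑ i, x i ^ 2) - 1) * eval x Y

/-- A moment functional is positive definite if it is positive on squares of nonzero polynomials. -/
def IsPosDefFunctional {d : ℕ} (F : MvPolynomial (Fin d) ℝ →ₗ[ℝ] ℝ) : Prop :=
  ∀ p, p ≠ 0 → 0 < F (p * p)

/-- `k` is the reproducing kernel of `F` in degree at most `n`, with one argument fixed at `x`. -/
def IsReproducing {d : ℕ} (F : MvPolynomial (Fin d) ℝ →ₗ[ℝ] ℝ) (n : ℕ) (x : Fin d → ℝ)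
    (k : MvPolynomial (Fin d) ℝ) : Prop :=
  k.totalDegree ≤ n ∧ ∀ p : MvPolynomial (Fin d) ℝ, p.totalDegree ≤ n → F (k * p) = eval x p

open Classical in
/-- The diagonal `K_n(F; x, x)` of the reproducing kernel (zero if there is no kernel). -/
noncomputable def diagKernel {d : ℕ} (F : MvPolynomial (Fin d) ℝ →ₗ[ℝ] ℝ) (n : ℕ)
    (x : Fin d → ℝ) : ℝ :=
  if h : ∃ k, IsReproducing F n x k then eval x h.choose else 0

section Kernel

variable {d : ℕ} {F G : MvPolynomial (Fin d) ℝ →ₗ[ℝ] ℝ}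

theorem IsReproducing.diagKernel_eq {n : ℕ} {x : Fin d → ℝ} {k : MvPolynomial (Fin d) ℝ}
    (hk : IsReproducing F n x k) : diagKernel F n x = eval x k := by
  have h : ∃ k, IsReproducing F n x k := ⟨k, hk⟩
  have h2 := h.choose_spec
  rw [diagKernel, dif_pos h, ← hk.2 _ h2.1, mul_comm, h2.2 _ hk.1]

theorem finrank_restrictTotalDegree (d n : ℕ) :
    Module.finrank ℝ (restrictTotalDegree (Fin d) ℝ n) = (n + d).choose d := by
  classical
  rw [restrictTotalDegree, Module.finrank_eq_nat_card_basis (basisRestrictSupport ℝ _),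
    ← Nat.sum_range_multichoose]
  have h : {s : Fin d →₀ ℕ | (s.sum fun _ e => e) ≤ n} =
      ((Finset.range (n + 1)).biUnion fun m => Finset.finsuppAntidiag Finset.univ m :
        Finset (Fin d →₀ ℕ)) := by
    ext s
    simp [Finset.mem_finsuppAntidiag, Finsupp.sum_fintype]
  rw [h, Nat.card_coe_set_eq, Set.ncard_coe_finset, Finset.card_biUnion]
  · simp [Finset.card_finsuppAntidiag_nat_eq_multichoose]
  · intro a _ b _ hab
    rw [Function.onFun, Finset.disjoint_left]
    intro s hs ht
    rw [Finset.mem_finsuppAntidiag] at hs ht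
    exact hab (hs.1.symm.trans ht.1)

theorem IsPosDefFunctional.exists_orthonormal (hF : IsPosDefFunctional F) (n : ℕ) :
    ∃ e : Fin ((n + d).choose d) → MvPolynomial (Fin d) ℝ,
      (∀ j, (e j).totalDegree ≤ n) ∧ (∀ i j, F (e i * e j) = if i = j then 1 else 0) ∧
      ∀ p : MvPolynomial (Fin d) ℝ, p.totalDegree ≤ n → p = ∑ j, F (p * e j) • e j := by
  rw [← finrank_restrictTotalDegree]
  let V := restrictTotalDegree (Fin d) ℝ n
  let B : LinearMap.BilinForm ℝ V :=
    ((LinearMap.mul ℝ (MvPolynomial (Fin d) ℝ)).compr₂ F).domRestrict₁₂ V V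
  have hB : ∀ p q : V, B p q = F (p * q) := fun p q => rfl
  obtain ⟨v, hv⟩ := LinearMap.BilinForm.exists_orthogonal_basis (B := B)
    ⟨fun p q => by simp [hB, mul_comm]⟩
  have hpos : ∀ i, 0 < F (v i * v i) := fun i => hF _ (by
    simpa using v.ne_zero i)
  have hort : ∀ i j, i ≠ j → F (v i * v j) = 0 := fun i j hij => by
    simpa [hB] using hv hij
  refine ⟨fun i => (Real.sqrt (F (v i * v i)))⁻¹ • (v i : MvPolynomial (Fin d) ℝ), ?_, ?_, ?_⟩
  · intro j
    exact (totalDegree_smul_le _ _).trans ((mem_restrictTotalDegree _ _ _).1 (v j).2)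
  · intro i j
    have hs := Real.mul_self_sqrt (hpos i).le
    have hs0 := (Real.sqrt_pos.2 (hpos i)).ne'
    rcases eq_or_ne i j with rfl | hij
    · simp only [smul_mul_smul_comm, map_smul, smul_eq_mul, if_true]
      field_simp
      rw [sq, hs]
    · simp [hort i j hij, hij]
  · intro p hp
    have h1 := v.sum_repr ⟨p, (mem_restrictTotalDegree _ _ _).2 hp⟩
    have h2 := congrArg (Subtype.val) h1
    simp only [Submodule.coe_sum, Submodule.coe_smul] at h2
    set c := v.repr ⟨p, (mem_restrictTotalDegree _ _ _).2 hp⟩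
    have h3 : ∀ j, F (p * v j) = c j * F (v j * v j) := by
      intro j
      conv_lhs => rw [← h2]
      rw [Finset.sum_mul, map_sum, Finset.sum_eq_single j]
      · simp
      · intro i _ hij
        simp [hort i j hij]
      · simp
    conv_lhs => rw [← h2]
    refine Finset.sum_congr rfl fun j _ => ?_
    have hs := Real.mul_self_sqrt (hpos j).le
    have hs0 := (Real.sqrt_pos.2 (hpos j)).ne'
    rw [mul_smul_comm, map_smul, h3, smul_smul, smul_eq_mul]
    congr 1
    field_simp
    rw [sq, hs]

theorem isReproducing_of_orthonormal {ι : Type*} [Fintype ι] {n : ℕ}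
    {e : ι → MvPolynomial (Fin d) ℝ} (he : ∀ j, (e j).totalDegree ≤ n)
    (hexp : ∀ p : MvPolynomial (Fin d) ℝ, p.totalDegree ≤ n → p = ∑ j, F (p * e j) • e j)
    (x : Fin d → ℝ) : IsReproducing F n x (∑ j, eval x (e j) • e j) := by
  refine ⟨totalDegree_finsetSum_le fun j _ => (totalDegree_smul_le _ _).trans (he j), ?_⟩
  intro p hp
  conv_rhs => rw [hexp p hp]
  rw [mul_comm, Finset.mul_sum]
  simp [smul_eval, mul_comm]

theorem diagKernel_eq_sum_sq {ι : Type*} [Fintype ι] {n : ℕ}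
    {e : ι → MvPolynomial (Fin d) ℝ} (he : ∀ j, (e j).totalDegree ≤ n)
    (hexp : ∀ p : MvPolynomial (Fin d) ℝ, p.totalDegree ≤ n → p = ∑ j, F (p * e j) • e j)
    (x : Fin d → ℝ) : diagKernel F n x = ∑ j, eval x (e j) ^ 2 := by
  rw [(isReproducing_of_orthonormal he hexp x).diagKernel_eq]
  simp [smul_eval, sq]

theorem IsPosDefFunctional.exists_isReproducing (hF : IsPosDefFunctional F) (n : ℕ)
    (x : Fin d → ℝ) : ∃ k, IsReproducing F n x k := by
  obtain ⟨e, he, _, hexp⟩ := hF.exists_orthonormal n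
  exact ⟨_, isReproducing_of_orthonormal he hexp x⟩

theorem IsReproducing.apply_self {n : ℕ} {x : Fin d → ℝ} {k : MvPolynomial (Fin d) ℝ}
    (hk : IsReproducing F n x k) : F (k * k) = diagKernel F n x := by
  rw [hk.2 k hk.1, hk.diagKernel_eq]

theorem IsPosDefFunctional.diagKernel_pos (hF : IsPosDefFunctional F) (n : ℕ) (x : Fin d → ℝ) :
    0 < diagKernel F n x := by
  obtain ⟨k, hk⟩ := hF.exists_isReproducing n x
  rw [← hk.apply_self]
  refine hF k ?_
  rintro rfl
  have := hk.2 1 (by simp)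
  simp at this

/-- The Christoffel extremal inequality. -/
theorem IsPosDefFunctional.sq_eval_le (hF : IsPosDefFunctional F) {n : ℕ} (x : Fin d → ℝ)
    {p : MvPolynomial (Fin d) ℝ} (hp : p.totalDegree ≤ n) :
    eval x p ^ 2 ≤ diagKernel F n x * F (p * p) := by
  obtain ⟨k, hk⟩ := hF.exists_isReproducing n x
  have hpos := hF.diagKernel_pos n x
  have h1 := hk.2 p hp
  have h2 := hk.apply_self
  set κ := diagKernel F n x
  have hnn : ∀ q, 0 ≤ F (q * q) := fun q => by
    rcases eq_or_ne q 0 with rfl | hq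
    · simp
    · exact (hF q hq).le
  have h3 := hnn (κ • p - eval x p • k)
  have h4 : F ((κ • p - eval x p • k) * (κ • p - eval x p • k)) =
      κ * (κ * F (p * p) - eval x p ^ 2) := by
    have : (κ • p - eval x p • k) * (κ • p - eval x p • k) =
        (κ * κ) • (p * p) - (2 * κ * eval x p) • (k * p) + (eval x p * eval x p) • (k * k) := by
      simp only [smul_eq_C_mul, C_mul, map_ofNat]
      ring
    rw [this]
    simp only [map_add, map_sub, map_smul, smul_eq_mul, h1, h2]
    ring
  rw [h4] at h3
  have := nonneg_of_mul_nonneg_right h3 hpos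
  linarith

/-- Comparison of kernels through multiplication by a fixed polynomial. -/
theorem IsPosDefFunctional.diagKernel_le_mul (hF : IsPosDefFunctional F)
    (hG : IsPosDefFunctional G) {g : MvPolynomial (Fin d) ℝ} {D n N : ℕ} (hg : g.totalDegree ≤ D)
    (hN : n + D ≤ N) {c : ℝ} (h : ∀ p, G (g * p * (g * p)) ≤ c * F (p * p)) (x : Fin d → ℝ) :
    eval x g ^ 2 * diagKernel F n x ≤ c * diagKernel G N x := by
  obtain ⟨k, hk⟩ := hF.exists_isReproducing n x
  have h1 := hG.sq_eval_le (n := N) x (p := g * k)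
    ((totalDegree_mul _ _).trans (by have := hk.1; omega))
  have h2 := h k
  have hpos := hF.diagKernel_pos n x
  have hposG := hG.diagKernel_pos N x
  rw [hk.apply_self] at h2
  rw [eval_mul, ← hk.diagKernel_eq] at h1
  have h3 := h1.trans (mul_le_mul_of_nonneg_left h2 hposG.le)
  refine le_of_mul_le_mul_right ?_ hpos
  linarith

theorem IsPosDefFunctional.diagKernel_mono (hF : IsPosDefFunctional F) (x : Fin d → ℝ) :
    Monotone fun n => diagKernel F n x := by
  intro m n hmn
  have := hF.diagKernel_le_mul hF (g := 1) (D := 0) (n := m) (N := n) (by simp) (by simpa)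
    (c := 1) (by simp) x
  simpa using this

end Kernel

section OrthogonalSystem

variable {d : ℕ} {F : MvPolynomial (Fin d) ℝ →ₗ[ℝ] ℝ} {P : PolySystem d}

theorem IsOPS.apply_mul_eq_zero (h : IsOPS F P) {n : ℕ} (β : Idx d n) {p : MvPolynomial (Fin d) ℝ}
    (hp : p.totalDegree < n) : F (p * P.vec n β) = 0 := by
  rw [p.as_sum, Finset.sum_mul, map_sum]
  refine Finset.sum_eq_zero fun ν hν => ?_
  have hle : (ν.sum fun _ e => e) < n := (le_totalDegree hν).trans_lt hp
  have hmem : ⇑ν ∈ Finset.Nat.antidiagonalTuple d (ν.sum fun _ e => e) := by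
    rw [Finset.Nat.mem_antidiagonalTuple, Finsupp.sum_fintype _ _ (fun _ => rfl)]
  have h0 := h.1 _ n hle ⟨⇑ν, hmem⟩ β
  have h1 : monomial ν (coeff ν p) =
      coeff ν p • monIdx (⟨⇑ν, hmem⟩ : Idx d (ν.sum fun _ e => e)) := by
    simp [monIdx, smul_monomial]
  rw [h1, smul_mul_assoc, map_smul, h0, smul_zero]

theorem IsOPS.apply_vec_mul_vec_of_ne (h : IsOPS F P) {m n : ℕ} (hmn : m ≠ n) (α : Idx d m)
    (β : Idx d n) : F (P.vec m α * P.vec n β) = 0 := by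
  rcases lt_or_gt_of_ne hmn with hlt | hlt
  · exact h.apply_mul_eq_zero β (by rwa [P.degree_eq])
  · rw [mul_comm]
    exact h.apply_mul_eq_zero α (by rwa [P.degree_eq])

theorem Hmat_posDef (hF : IsPosDefFunctional F) (P : PolySystem d) (n : ℕ) :
    (Hmat F P n).PosDef := by
  refine Matrix.PosDef.of_dotProduct_mulVec_pos ?_ ?_
  · ext α β
    simp [Hmat, mul_comm]
  · intro x hx
    have h1 : star x ⬝ᵥ (Hmat F P n *ᵥ x) =
        F ((∑ α, x α • P.vec n α) * (∑ α, x α • P.vec n α)) := by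
      simp only [dotProduct, mulVec, Hmat, Finset.sum_mul, Finset.mul_sum, map_sum, of_apply,
        smul_mul_smul_comm, map_smul, smul_eq_mul, star_trivial]
      refine Finset.sum_congr rfl fun α _ => Finset.sum_congr rfl fun β _ => ?_
      ring_nf
    rw [h1]
    refine hF _ fun h0 => hx ?_
    have hli : LinearIndependent ℝ (P.vec n) :=
      P.indep.comp (fun α : Idx d n => (⟨n, α⟩ : Σ n : ℕ, Idx d n)) (sigma_mk_injective)
    funext α
    exact Fintype.linearIndependent_iff.1 hli x h0 α

theorem IsOPS.kerLT_eq_diagKernel (h : IsOPS F P) (hF : IsPosDefFunctional F) (n : ℕ)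
    (x : Fin d → ℝ) : kerLT F P (n + 1) x x = diagKernel F n x := by
  let k : MvPolynomial (Fin d) ℝ := ∑ m ∈ Finset.range (n + 1), ∑ α, ∑ β,
    (eval x (P.vec m α) * (Hmat F P m)⁻¹ α β) • P.vec m β
  have hk : IsReproducing F n x k := by
    constructor
    · refine totalDegree_finsetSum_le fun m hm => totalDegree_finsetSum_le fun α _ =>
        totalDegree_finsetSum_le fun β _ => (totalDegree_smul_le _ _).trans ?_
      rw [P.degree_eq]
      exact Nat.lt_succ_iff.1 (Finset.mem_range.1 hm)
    · intro p hp
      have hspan := P.spans n p hp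
      clear hp
      induction hspan using Submodule.span_induction with
      | mem q hq =>
        obtain ⟨m, hm, γ, rfl⟩ := hq
        have hinv : (Hmat F P m)⁻¹ * Hmat F P m = 1 :=
          Matrix.nonsing_inv_mul _ ((Matrix.isUnit_iff_isUnit_det _).1 (Hmat_posDef hF P m).isUnit)
        simp only [k, Finset.sum_mul, map_sum, smul_mul_assoc, map_smul, smul_eq_mul]
        rw [Finset.sum_eq_single m]
        · have h2 : ∀ α, ∑ β, eval x (P.vec m α) * (Hmat F P m)⁻¹ α β *
              F (P.vec m β * P.vec m γ) = eval x (P.vec m α) * (1 : Matrix _ _ ℝ) α γ := by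
            intro α
            rw [← hinv, Matrix.mul_apply, Finset.mul_sum]
            simp [Hmat, mul_assoc]
          simp only [h2, Matrix.one_apply, mul_ite, mul_one, mul_zero, Finset.sum_ite_eq',
            Finset.mem_univ, if_true]
        · intro l _ hl
          refine Finset.sum_eq_zero fun α _ => Finset.sum_eq_zero fun β _ => ?_
          rw [h.apply_vec_mul_vec_of_ne hl, mul_zero]
        · intro hm'
          exact absurd (Finset.mem_range.2 (Nat.lt_succ_of_le hm)) hm'
      | zero => simp
      | add p q _ _ hp hq => rw [mul_add, map_add, map_add, hp, hq]
      | smul c p _ hp => rw [mul_smul_comm, map_smul, hp, smul_eval, smul_eq_mul]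
  rw [hk.diagKernel_eq]
  simp [k, kerLT, kerP, smul_eval]

end OrthogonalSystem

section SphereIdentity

variable {d : ℕ}

/-- The polynomial `1 - ‖x‖²`. -/
noncomputable def rhoPoly (d : ℕ) : MvPolynomial (Fin d) ℝ := 1 - ∑ i, X i ^ 2

theorem eval_rhoPoly (x : Fin d → ℝ) : eval x (rhoPoly d) = 1 - ∑ i, x i ^ 2 := by
  simp [rhoPoly]

theorem totalDegree_rhoPoly_le : (rhoPoly d).totalDegree ≤ 2 := by
  refine (totalDegree_sub _ _).trans (max_le (by simp) ?_)
  refine totalDegree_finsetSum_le fun i _ => (totalDegree_pow _ _).trans ?_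
  simp

theorem pderiv_rhoPoly (i : Fin d) : pderiv i (rhoPoly d) = -2 * X i := by
  simp only [rhoPoly, map_sub, pderiv_one, map_sum, Derivation.leibniz_pow, pderiv_X, zero_sub,
    nsmul_eq_mul, smul_eq_mul]
  rw [Finset.sum_eq_single i]
  · simp
  · intro j _ hj
    simp [hj.symm]
  · simp

/-- The functional `p ↦ F ((1 - ‖x‖²) p)`. -/
noncomputable def rhoMul (F : MvPolynomial (Fin d) ℝ →ₗ[ℝ] ℝ) : MvPolynomial (Fin d) ℝ →ₗ[ℝ] ℝ :=
  F ∘ₗ LinearMap.mulLeft ℝ (rhoPoly d)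

theorem rhoMul_apply (F : MvPolynomial (Fin d) ℝ →ₗ[ℝ] ℝ) (p : MvPolynomial (Fin d) ℝ) :
    rhoMul F p = F (rhoPoly d * p) := rfl

theorem totalDegree_pderiv_le {n : ℕ} (i : Fin d) {p : MvPolynomial (Fin d) ℝ}
    (hp : p.totalDegree ≤ n + 1) : (pderiv i p).totalDegree ≤ n := by
  refine Finset.sup_le fun ν hν => ?_
  rw [mem_support_iff, coeff_pderiv] at hν
  have h1 := le_totalDegree (mem_support_iff.2 (left_ne_zero_of_mul hν))
  rw [Finsupp.sum_add_index' (fun _ => rfl) (fun _ _ _ => rfl), Finsupp.sum_single_index rfl] at h1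
  omega

theorem eq_C_of_pderiv_eq_zero {p : MvPolynomial (Fin d) ℝ} (h : ∀ i, pderiv i p = 0) :
    p = C (coeff 0 p) := by
  ext ν
  rw [coeff_C]
  split_ifs with hν
  · rw [hν]
  · obtain ⟨i, hi⟩ : ∃ i, ν i ≠ 0 := by
      by_contra! h0
      exact hν (Finsupp.ext fun i => (h0 i).symm)
    have h1 := congrArg (coeff (ν - Finsupp.single i 1)) (h i)
    rw [coeff_pderiv, tsub_add_cancel_of_le (by simpa [Nat.one_le_iff_ne_zero] using hi),
      coeff_zero, mul_eq_zero] at h1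
    exact h1.resolve_right (by positivity)

/-- The addition formula on the diagonal for spherical polynomials, written on the ball: it
only uses that `F` is annihilated by the infinitesimal rotations of the sphere above the ball. -/
theorem diagKernel_add_rhoMul_diagKernel {F : MvPolynomial (Fin d) ℝ →ₗ[ℝ] ℝ}
    (hF : IsPosDefFunctional F) (hG : IsPosDefFunctional (rhoMul F))
    (hibp : ∀ i q, F (rhoPoly d * pderiv i q - X i * q) = 0) (n : ℕ) (x : Fin d → ℝ) :
    diagKernel F (n + 1) x + (1 - ∑ i, x i ^ 2) * diagKernel (rhoMul F) n x =
      (((n + 1 + d).choose d : ℝ) + ((n + d).choose d : ℝ)) / F 1 := by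
  obtain ⟨e, he, heo, heexp⟩ := hF.exists_orthonormal (n + 1)
  obtain ⟨f, hf, hfo, hfexp⟩ := hG.exists_orthonormal n
  set T : MvPolynomial (Fin d) ℝ := ∑ j, e j * e j + rhoPoly d * ∑ k, f k * f k with hT
  have hd : ∀ i, pderiv i T = 0 := by
    intro i
    have h1 : ∀ j, pderiv i (e j) = ∑ k, F (rhoPoly d * (pderiv i (e j) * f k)) • f k := fun j =>
      hfexp _ (totalDegree_pderiv_le i (he j))
    have h2 : ∀ k, rhoPoly d * pderiv i (f k) - X i * f k =
        ∑ j, F ((rhoPoly d * pderiv i (f k) - X i * f k) * e j) • e j := fun k =>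
      heexp _ (by
        refine (totalDegree_sub _ _).trans (max_le ?_ ?_)
        · rcases Nat.eq_zero_or_pos n with rfl | hn
          · have : pderiv i (f k) = 0 := by
              rw [totalDegree_eq_zero_iff_eq_C.1 (Nat.le_zero.1 (hf k)), pderiv_C]
            simp [this]
          · obtain ⟨m, rfl⟩ : ∃ m, n = m + 1 := ⟨n - 1, by omega⟩
            have := totalDegree_pderiv_le i (hf k)
            have h3 := totalDegree_rhoPoly_le (d := d)
            have h4 := totalDegree_mul (rhoPoly d) (pderiv i (f k))
            omega
        · have h4 := totalDegree_mul (X i : MvPolynomial (Fin d) ℝ) (f k)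
          rw [totalDegree_X] at h4
          have := hf k
          omega)
    have h5 : pderiv i T = 2 * (∑ j, e j * pderiv i (e j) +
        ∑ k, (rhoPoly d * pderiv i (f k) - X i * f k) * f k) := by
      simp only [hT, map_add, map_sum, Derivation.leibniz, smul_eq_mul, pderiv_rhoPoly,
        Finset.mul_sum, mul_add]
      congr 1
      · exact Finset.sum_congr rfl fun j _ => by ring
      · exact Finset.sum_congr rfl fun j _ => by ring
    have h6 : ∑ j, e j * pderiv i (e j) =
        ∑ j, ∑ k, F (rhoPoly d * (pderiv i (e j) * f k)) • (e j * f k) := by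
      refine Finset.sum_congr rfl fun j _ => ?_
      conv_lhs => rw [h1 j]
      simp [Finset.mul_sum]
    have h7 : ∑ k, (rhoPoly d * pderiv i (f k) - X i * f k) * f k =
        ∑ j, ∑ k, F ((rhoPoly d * pderiv i (f k) - X i * f k) * e j) • (e j * f k) := by
      rw [Finset.sum_comm]
      refine Finset.sum_congr rfl fun k _ => ?_
      conv_lhs => rw [h2 k]
      simp [Finset.sum_mul]
    rw [h5, h6, h7, ← Finset.sum_add_distrib, Finset.sum_eq_zero, mul_zero]
    intro j _
    rw [← Finset.sum_add_distrib]
    refine Finset.sum_eq_zero fun k _ => ?_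
    rw [← add_smul, ← map_add]
    have h8 : rhoPoly d * (pderiv i (e j) * f k) +
        (rhoPoly d * pderiv i (f k) - X i * f k) * e j =
        rhoPoly d * pderiv i (e j * f k) - X i * (e j * f k) := by
      rw [Derivation.leibniz, smul_eq_mul, smul_eq_mul]
      ring
    rw [h8, hibp, zero_smul]
  have hC := eq_C_of_pderiv_eq_zero hd
  have hF1 : F 1 ≠ 0 := by simpa using (hF 1 one_ne_zero).ne'
  have hFT : F T = ((n + 1 + d).choose d : ℝ) + ((n + d).choose d : ℝ) := by
    have h9 : ∀ k, F (rhoPoly d * (f k * f k)) = 1 := fun k => by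
      rw [← rhoMul_apply, hfo, if_pos rfl]
    simp [hT, Finset.mul_sum, heo, h9]
  have hc : coeff 0 T * F 1 = ((n + 1 + d).choose d : ℝ) + ((n + d).choose d : ℝ) := by
    rw [← hFT]
    conv_rhs => rw [hC]
    rw [C_eq_smul_one, map_smul, smul_eq_mul]
  rw [diagKernel_eq_sum_sq he heexp, diagKernel_eq_sum_sq hf hfexp, ← hc,
    mul_div_cancel_right₀ _ hF1]
  have := congrArg (eval x) hC
  rw [eval_C] at this
  rw [← this, hT]
  simp [eval_rhoPoly, sq]

end SphereIdentity

section Weight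

theorem integrable_betaPDFReal {a b : ℝ} (ha : 0 < a) (hb : 0 < b) :
    Integrable (ProbabilityTheory.betaPDFReal a b) ∧
      ∫ x, ProbabilityTheory.betaPDFReal a b x = 1 := by
  have hnn : ∀ x, 0 ≤ ProbabilityTheory.betaPDFReal a b x := fun x => by
    by_cases h : 0 < x ∧ x < 1
    · exact (ProbabilityTheory.betaPDFReal_pos h.1 h.2 ha hb).le
    · rw [ProbabilityTheory.betaPDFReal, if_neg h]
  have h1 := ProbabilityTheory.lintegral_betaPDF_eq_one ha hb
  simp only [ProbabilityTheory.betaPDF] at h1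
  have hm := (ProbabilityTheory.measurable_betaPDFReal a b).aestronglyMeasurable (μ := volume)
  constructor
  · refine ⟨hm, ?_⟩
    rw [hasFiniteIntegral_iff_ofReal (Filter.Eventually.of_forall hnn), h1]
    exact ENNReal.one_lt_top
  · rw [integral_eq_lintegral_of_nonneg_ae (Filter.Eventually.of_forall hnn) hm, h1]
    rfl

/-- The weight `(1 - r²)^{-1/2}` on `[0, 1]`, extended by zero. -/
noncomputable def chebyshevProfile (r : ℝ) : ℝ :=
  if r ^ 2 ≤ 1 then (1 - r ^ 2) ^ (-1 / 2 : ℝ) else 0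

theorem pow_mul_chebyshevProfile {d : ℕ} (hd : 0 < d) {r : ℝ} (hr : 0 < r) :
    r ^ (d - 1) * chebyshevProfile r = ProbabilityTheory.beta ((d : ℝ) / 2) (1 / 2) / 2 *
      ((|2| * r ^ ((2 : ℝ) - 1)) *
        ProbabilityTheory.betaPDFReal ((d : ℝ) / 2) (1 / 2) (r ^ (2 : ℝ))) := by
  have hB := ProbabilityTheory.beta_pos (α := (d : ℝ) / 2) (β := 1 / 2) (by positivity)
    (by norm_num)
  have hr2 : r ^ (2 : ℝ) = r ^ 2 := by norm_cast
  rw [chebyshevProfile, ProbabilityTheory.betaPDFReal, hr2]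
  rcases lt_trichotomy (r ^ 2) 1 with h | h | h
  · rw [if_pos h.le, if_pos ⟨by positivity, h⟩, ← Real.rpow_natCast r (d - 1), ← hr2,
      ← Real.rpow_mul hr.le]
    have h1 : r ^ ((d - 1 : ℕ) : ℝ) = r ^ ((2 : ℝ) - 1) * r ^ (2 * ((d : ℝ) / 2 - 1)) := by
      rw [← Real.rpow_add hr, Nat.cast_sub hd]
      congr 1
      push_cast
      ring
    rw [h1, show (-1 / 2 : ℝ) = 1 / 2 - 1 by norm_num, abs_of_pos (by norm_num : (0 : ℝ) < 2)]
    field_simp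
  · rw [h, if_pos le_rfl, if_neg (by simp)]
    norm_num
  · rw [if_neg h.not_ge, if_neg (fun h' => h.not_gt h'.2)]
    simp

theorem integrable_chebyshevProfile {d : ℕ} (hd : 0 < d) :
    IntegrableOn (fun r : ℝ => r ^ (d - 1) • chebyshevProfile r) (Set.Ioi 0) ∧
      ∫ r in Set.Ioi (0 : ℝ), r ^ (d - 1) • chebyshevProfile r =
        ProbabilityTheory.beta ((d : ℝ) / 2) (1 / 2) / 2 := by
  obtain ⟨h1, h2⟩ := integrable_betaPDFReal (a := (d : ℝ) / 2) (b := 1 / 2) (by positivity)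
    (by norm_num)
  have h3 : ∫ x in Set.Ioi (0 : ℝ), ProbabilityTheory.betaPDFReal ((d : ℝ) / 2) (1 / 2) x = 1 := by
    refine (setIntegral_eq_integral_of_forall_compl_eq_zero fun x hx => ?_).trans h2
    rw [ProbabilityTheory.betaPDFReal, if_neg fun h => hx h.1]
  have hI := (integrableOn_Ioi_comp_rpow_iff
    (ProbabilityTheory.betaPDFReal ((d : ℝ) / 2) (1 / 2)) (p := 2) (by norm_num)).2 h1.integrableOn
  constructor
  · refine IntegrableOn.congr_fun
      (Integrable.const_mul hI (ProbabilityTheory.beta ((d : ℝ) / 2) (1 / 2) / 2))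
      (fun r hr => ?_) measurableSet_Ioi
    simp only [smul_eq_mul]
    rw [pow_mul_chebyshevProfile hd hr]
  · rw [setIntegral_congr_fun measurableSet_Ioi (g := fun r : ℝ =>
      ProbabilityTheory.beta ((d : ℝ) / 2) (1 / 2) / 2 * ((|2| * r ^ ((2 : ℝ) - 1)) •
        ProbabilityTheory.betaPDFReal ((d : ℝ) / 2) (1 / 2) (r ^ (2 : ℝ))))
      (fun r hr => by simp only [smul_eq_mul]; rw [pow_mul_chebyshevProfile hd hr]),
      integral_const_mul, integral_comp_rpow_Ioi _ (by norm_num), h3, mul_one]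

theorem isCompact_ballSet (d : ℕ) : IsCompact (ballSet d) := by
  refine Metric.isCompact_of_isClosed_isBounded
    (isClosed_le (by fun_prop) continuous_const) ?_
  refine (Metric.isBounded_closedBall (x := (0 : Fin d → ℝ)) (r := 1)).subset fun x hx => ?_
  rw [mem_closedBall_zero_iff, pi_norm_le_iff_of_nonneg zero_le_one]
  intro i
  have h1 : x i ^ 2 ≤ ∑ j, x j ^ 2 :=
    Finset.single_le_sum (f := fun j => x j ^ 2) (fun j _ => sq_nonneg _) (Finset.mem_univ i)
  rw [Real.norm_eq_abs]
  exact abs_le_one_iff_mul_self_le_one.2 (by rw [← sq]; exact h1.trans hx)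

theorem measurableSet_ballSet (d : ℕ) : MeasurableSet (ballSet d) :=
  (isCompact_ballSet d).isClosed.measurableSet

theorem indicator_ballSet_eq {d : ℕ} :
    (ballSet d).indicator (fun x => (1 - ∑ i, x i ^ 2) ^ (-1 / 2 : ℝ)) =
      fun x => chebyshevProfile ‖WithLp.toLp 2 x‖ := by
  funext x
  rw [chebyshevProfile, EuclideanSpace.real_norm_sq_eq]
  by_cases h : ∑ i, x i ^ 2 ≤ 1
  · rw [Set.indicator_of_mem (show x ∈ ballSet d from h), if_pos h]
  · rw [Set.indicator_of_notMem (show x ∉ ballSet d from h), if_neg h]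

theorem integrableOn_chebyshev {d : ℕ} (hd : 0 < d) :
    IntegrableOn (fun x : Fin d → ℝ => (1 - ∑ i, x i ^ 2) ^ (-1 / 2 : ℝ)) (ballSet d) := by
  have : Nonempty (Fin d) := ⟨⟨0, hd⟩⟩
  rw [← integrable_indicator_iff (measurableSet_ballSet d), indicator_ballSet_eq]
  have h := (integrable_fun_norm_addHaar (volume : Measure (EuclideanSpace ℝ (Fin d)))
    (f := chebyshevProfile)).2 (by simpa using (integrable_chebyshevProfile hd).1)
  exact (PiLp.volume_preserving_toLp (Fin d)).integrable_comp_of_integrable h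

theorem integral_chebyshev {d : ℕ} (hd : 0 < d) :
    omegaMu d 0 * ∫ x in ballSet d, (1 - ∑ i, x i ^ 2) ^ (-1 / 2 : ℝ) = 1 := by
  have : Nonempty (Fin d) := ⟨⟨0, hd⟩⟩
  have hd' : (0 : ℝ) < d := by exact_mod_cast hd
  rw [← integral_indicator (measurableSet_ballSet d), indicator_ballSet_eq]
  have h := (PiLp.volume_preserving_toLp (Fin d)).integral_comp
    (MeasurableEquiv.toLp 2 (Fin d → ℝ)).measurableEmbedding
    (fun y : EuclideanSpace ℝ (Fin d) => chebyshevProfile ‖y‖)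
  rw [h, integral_fun_norm_addHaar]
  simp only [finrank_euclideanSpace, Fintype.card_fin]
  rw [(integrable_chebyshevProfile hd).2, Measure.real, EuclideanSpace.volume_ball]
  simp only [Fintype.card_fin, ENNReal.ofReal_one, one_pow, one_mul, nsmul_eq_mul, smul_eq_mul]
  have hG1 := Real.Gamma_pos_of_pos (s := (d : ℝ) / 2) (by positivity)
  have hG2 := Real.Gamma_pos_of_pos (s := ((d : ℝ) + 1) / 2) (by positivity)
  have hpi := Real.sqrt_pos.2 Real.pi_pos
  have hpow : Real.pi ^ ((d : ℝ) / 2) = Real.sqrt Real.pi ^ d := by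
    rw [Real.sqrt_eq_rpow, ← Real.rpow_natCast, ← Real.rpow_mul Real.pi_pos.le]
    congr 1
    ring
  rw [Real.Gamma_add_one (by positivity), ENNReal.toReal_ofReal (by positivity), omegaMu,
    ProbabilityTheory.beta, hpow, zero_add, zero_add, Real.Gamma_one_half_eq,
    show (d : ℝ) / 2 + 1 / 2 = ((d : ℝ) + 1) / 2 by ring]
  field_simp

end Weight

section WeightFunctional

variable {d : ℕ}

theorem integrableOn_eval_mul_rpow (hd : 0 < d) {a : ℝ} (ha : -1 / 2 ≤ a)
    (p : MvPolynomial (Fin d) ℝ) :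
    IntegrableOn (fun x : Fin d → ℝ => eval x p * (1 - ∑ i, x i ^ 2) ^ a) (ballSet d) := by
  refine IntegrableOn.continuousOn_mul (MvPolynomial.continuous_eval p).continuousOn ?_
    (isCompact_ballSet d)
  have h1 : IntegrableOn (fun x : Fin d → ℝ => (1 - ∑ i, x i ^ 2) ^ (-1 / 2 : ℝ) + 1)
      (ballSet d) := (integrableOn_chebyshev hd).add
    (integrableOn_const (isCompact_ballSet d).measure_lt_top.ne)
  refine Integrable.mono' h1 (by
    have : Measurable fun x : Fin d → ℝ => (1 - ∑ i, x i ^ 2) ^ a := by measurability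
    exact this.aestronglyMeasurable) ?_
  filter_upwards [ae_restrict_mem (measurableSet_ballSet d)] with x hx
  have h0 : 0 ≤ 1 - ∑ i, x i ^ 2 := sub_nonneg.2 hx
  have hle : 1 - ∑ i, x i ^ 2 ≤ 1 := sub_le_self _ (Finset.sum_nonneg fun i _ => sq_nonneg _)
  rw [Real.norm_of_nonneg (Real.rpow_nonneg h0 _)]
  rcases h0.eq_or_lt with h | h
  · rw [← h]
    have := Real.zero_rpow_le_one a
    have := Real.zero_rpow_nonneg (-1 / 2)
    linarith
  · have := Real.rpow_le_rpow_of_exponent_ge h hle ha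
    linarith

/-- The functional `p ↦ ∫ p(x) (1 - ‖x‖²)^a dx` over the unit ball. -/
noncomputable def weightFunctional (hd : 0 < d) {a : ℝ} (ha : -1 / 2 ≤ a) :
    MvPolynomial (Fin d) ℝ →ₗ[ℝ] ℝ where
  toFun p := ∫ x in ballSet d, eval x p * (1 - ∑ i, x i ^ 2) ^ a
  map_add' p q := by
    simp only [map_add, add_mul]
    exact integral_add (integrableOn_eval_mul_rpow hd ha p) (integrableOn_eval_mul_rpow hd ha q)
  map_smul' c p := by
    simp only [smul_eval, RingHom.id_apply, smul_eq_mul, mul_assoc]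
    exact integral_const_mul _ _

theorem weightFunctional_apply (hd : 0 < d) {a : ℝ} (ha : -1 / 2 ≤ a)
    (p : MvPolynomial (Fin d) ℝ) :
    weightFunctional hd ha p = ∫ x in ballSet d, eval x p * (1 - ∑ i, x i ^ 2) ^ a := rfl

theorem exists_eval_ne_zero_of_sum_sq_lt_one {p : MvPolynomial (Fin d) ℝ} (hp : p ≠ 0) :
    ∃ x : Fin d → ℝ, ∑ i, x i ^ 2 < 1 ∧ eval x p ≠ 0 := by
  by_contra! h
  refine hp (MvPolynomial.funext_set (fun _ => Set.Ioo (0 : ℝ) (1 / (d + 1))) (fun _ => ?_) ?_)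
  · exact Set.Ioo_infinite (by positivity)
  · intro x hx
    rw [map_zero]
    refine h x ?_
    have h1 : ∀ i, x i ^ 2 ≤ 1 / ((d : ℝ) + 1) := fun i => by
      have h2 := hx i (Set.mem_univ i)
      have h3 : 1 / ((d : ℝ) + 1) ≤ 1 := by
        rw [div_le_one (by positivity)]
        linarith [Nat.cast_nonneg (α := ℝ) d]
      nlinarith [h2.1, h2.2]
    calc ∑ i, x i ^ 2 ≤ ∑ _i : Fin d, 1 / ((d : ℝ) + 1) := Finset.sum_le_sum fun i _ => h1 i
      _ = d / ((d : ℝ) + 1) := by simp [div_eq_mul_inv]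
      _ < 1 := by
        rw [div_lt_one (by positivity)]
        linarith

theorem isPosDefFunctional_weightFunctional (hd : 0 < d) {a : ℝ} (ha : -1 / 2 ≤ a) :
    IsPosDefFunctional (weightFunctional hd ha) := by
  intro p hp
  rw [weightFunctional_apply, setIntegral_pos_iff_support_of_nonneg_ae ?_
    (integrableOn_eval_mul_rpow hd ha _)]
  · obtain ⟨x, hx, hxp⟩ := exists_eval_ne_zero_of_sum_sq_lt_one hp
    have hU : IsOpen {x : Fin d → ℝ | ∑ i, x i ^ 2 < 1 ∧ eval x p ≠ 0} :=
      IsOpen.and (isOpen_lt (by fun_prop) continuous_const)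
        (isOpen_ne_fun (MvPolynomial.continuous_eval p) continuous_const)
    refine (hU.measure_pos volume ⟨x, hx, hxp⟩).trans_le (measure_mono fun y hy => ?_)
    refine ⟨?_, hy.1.le⟩
    rw [Function.mem_support, map_mul]
    exact mul_ne_zero (mul_ne_zero hy.2 hy.2) (Real.rpow_pos_of_pos (sub_pos.2 hy.1) _).ne'
  · filter_upwards [ae_restrict_mem (measurableSet_ballSet d)] with x hx
    rw [map_mul]
    exact mul_nonneg (mul_self_nonneg _) (Real.rpow_nonneg (sub_nonneg.2 hx) _)

theorem rhoMul_weightFunctional (hd : 0 < d) :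
    rhoMul (weightFunctional hd (a := -1 / 2) le_rfl) =
      weightFunctional hd (a := 1 / 2) (by norm_num) := by
  refine LinearMap.ext fun p => ?_
  rw [rhoMul_apply, weightFunctional_apply, weightFunctional_apply]
  refine setIntegral_congr_fun (measurableSet_ballSet d) fun x hx => ?_
  simp only [map_mul, eval_rhoPoly]
  rcases (sub_nonneg.2 hx : 0 ≤ 1 - ∑ i, x i ^ 2).eq_or_lt with h | h
  · rw [← h, Real.zero_rpow (by norm_num)]
    simp
  · rw [mul_comm (1 - ∑ i, x i ^ 2), mul_assoc, ← Real.rpow_one_add' h.le (by norm_num)]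
    norm_num

theorem weightFunctional_mul_self_le (hd : 0 < d) {a b : ℝ} (ha : -1 / 2 ≤ a) (hb : -1 / 2 ≤ b)
    {g : MvPolynomial (Fin d) ℝ}
    (hg : ∀ x ∈ ballSet d, eval x g ^ 2 * (1 - ∑ i, x i ^ 2) ^ a ≤ (1 - ∑ i, x i ^ 2) ^ b)
    (p : MvPolynomial (Fin d) ℝ) :
    weightFunctional hd ha (g * p * (g * p)) ≤ weightFunctional hd hb (p * p) := by
  rw [weightFunctional_apply, weightFunctional_apply]
  refine setIntegral_mono_on (integrableOn_eval_mul_rpow hd ha _)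
    (integrableOn_eval_mul_rpow hd hb _) (measurableSet_ballSet d) fun x hx => ?_
  have := mul_le_mul_of_nonneg_left (hg x hx) (mul_self_nonneg (eval x p))
  simp only [map_mul]
  linarith

end WeightFunctional

section IntegrationByParts

theorem hasDerivAt_eval_insertNth {d : ℕ} (i : Fin (d + 1)) (y : Fin d → ℝ)
    (q : MvPolynomial (Fin (d + 1)) ℝ) (t : ℝ) :
    HasDerivAt (fun s : ℝ => eval (i.insertNth (α := fun _ => ℝ) s y) q)
      (eval (i.insertNth (α := fun _ => ℝ) t y) (pderiv i q)) t := by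
  induction q using MvPolynomial.induction_on with
  | C a => simpa using hasDerivAt_const t a
  | add p q hp hq =>
    simp only [map_add]
    exact hp.add hq
  | mul_X p j hp =>
    have hX : HasDerivAt (fun s : ℝ => i.insertNth (α := fun _ => ℝ) s y j)
        (eval (i.insertNth (α := fun _ => ℝ) t y) (pderiv i (X j))) t := by
      rcases Fin.eq_self_or_eq_succAbove i j with rfl | ⟨k, rfl⟩
      · simpa using! hasDerivAt_id t
      · simpa [pderiv_X, Pi.single_apply] using hasDerivAt_const t (y k)
    have h := hp.mul hX
    simp only [Derivation.leibniz, smul_eq_mul, map_add, map_mul, eval_X]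
    refine HasDerivAt.congr_deriv h ?_
    ring

theorem integral_slice_eq_zero {c : ℝ} {f f' : ℝ → ℝ} (hf : ∀ t, HasDerivAt f (f' t) t)
    (hint : Integrable ((Set.Icc (-√c) √c).indicator fun t =>
      ((c - t ^ 2) * f' t - t * f t) * (c - t ^ 2) ^ (-1 / 2 : ℝ))) :
    ∫ t in Set.Icc (-√c) √c, ((c - t ^ 2) * f' t - t * f t) * (c - t ^ 2) ^ (-1 / 2 : ℝ) = 0 := by
  have hle : -√c ≤ √c := by linarith [Real.sqrt_nonneg c]
  rw [integral_Icc_eq_integral_Ioc, ← intervalIntegral.integral_of_le hle,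
    intervalIntegral.integral_eq_sub_of_hasDerivAt_of_le (f := fun t => f t * √(c - t ^ 2)) hle]
  · rcases le_total c 0 with h | h
    · simp [Real.sqrt_eq_zero_of_nonpos h]
    · simp [Real.sq_sqrt h]
  · have : Continuous f := continuous_iff_continuousAt.2 fun t => (hf t).continuousAt
    fun_prop
  · intro t ht
    have hpos : 0 < c - t ^ 2 := by
      have h1 : |t| < √c := abs_lt.2 ht
      have h2 : t ^ 2 < c := by
        rw [← sq_abs]
        exact (Real.lt_sqrt (abs_nonneg t)).1 h1
      linarith
    have h1 : HasDerivAt (fun t => c - t ^ 2) (-(2 * t)) t := by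
      simpa using (hasDerivAt_pow 2 t).const_sub c
    refine ((hf t).mul (h1.sqrt hpos.ne')).congr_deriv ?_
    rw [neg_div 2 (1 : ℝ), Real.rpow_neg hpos.le, ← Real.sqrt_eq_rpow]
    have h2 := Real.sqrt_pos.2 hpos
    have h3 := Real.mul_self_sqrt hpos.le
    set s := √(c - t ^ 2)
    rw [← h3]
    field_simp
    ring
  · rw [intervalIntegrable_iff_integrableOn_Icc_of_le hle]
    exact (integrable_indicator_iff measurableSet_Icc).1 hint

theorem weightFunctional_integration_by_parts {d : ℕ} (hd : 0 < d) (i : Fin d)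
    (q : MvPolynomial (Fin d) ℝ) :
    weightFunctional hd (a := -1 / 2) le_rfl (rhoPoly d * pderiv i q - X i * q) = 0 := by
  obtain ⟨d, rfl⟩ := Nat.exists_eq_succ_of_ne_zero hd.ne'
  have hmp := (volume_preserving_piFinSuccAbove (fun _ : Fin (d + 1) => ℝ) i).symm
  have hI := integrableOn_eval_mul_rpow hd (a := -1 / 2) le_rfl
    (rhoPoly (d + 1) * pderiv i q - X i * q)
  rw [← integrable_indicator_iff (measurableSet_ballSet _)] at hI
  rw [weightFunctional_apply, ← integral_indicator (measurableSet_ballSet _)]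
  have hI2 := (hmp.integrable_comp_emb
    (MeasurableEquiv.piFinSuccAbove (fun _ : Fin (d + 1) => ℝ) i).symm.measurableEmbedding).2 hI
  rw [← hmp.integral_comp
    (MeasurableEquiv.piFinSuccAbove (fun _ : Fin (d + 1) => ℝ) i).symm.measurableEmbedding]
  have hslice : ∀ (y : Fin d → ℝ) (t : ℝ),
      (ballSet (d + 1)).indicator (fun x => eval x (rhoPoly (d + 1) * pderiv i q - X i * q) *
        (1 - ∑ j, x j ^ 2) ^ (-1 / 2 : ℝ))
        ((MeasurableEquiv.piFinSuccAbove (fun _ : Fin (d + 1) => ℝ) i).symm (t, y)) =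
      if 0 ≤ 1 - ∑ j, y j ^ 2 then
        (Set.Icc (-√(1 - ∑ j, y j ^ 2)) √(1 - ∑ j, y j ^ 2)).indicator (fun t =>
          (((1 - ∑ j, y j ^ 2) - t ^ 2) * eval (i.insertNth (α := fun _ => ℝ) t y) (pderiv i q) -
            t * eval (i.insertNth (α := fun _ => ℝ) t y) q) *
            ((1 - ∑ j, y j ^ 2) - t ^ 2) ^ (-1 / 2 : ℝ)) t
      else 0 := by
    intro y t
    have hsymm : (MeasurableEquiv.piFinSuccAbove (fun _ : Fin (d + 1) => ℝ) i).symm (t, y) =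
        i.insertNth (α := fun _ => ℝ) t y := rfl
    have hsum : ∑ j, (i.insertNth (α := fun _ => ℝ) t y j) ^ 2 = t ^ 2 + ∑ j, y j ^ 2 := by
      rw [Fin.sum_univ_succAbove _ i]
      simp
    have hρ : 1 - (t ^ 2 + ∑ j, y j ^ 2) = (1 - ∑ j, y j ^ 2) - t ^ 2 := by ring
    rw [hsymm]
    have hmem : i.insertNth (α := fun _ => ℝ) t y ∈ ballSet (d + 1) ↔
        t ^ 2 ≤ 1 - ∑ j, y j ^ 2 := by
      rw [ballSet, Set.mem_ofPred_eq, hsum]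
      constructor <;> intro <;> linarith
    split_ifs with hc
    · have hmem2 : t ∈ Set.Icc (-√(1 - ∑ j, y j ^ 2)) √(1 - ∑ j, y j ^ 2) ↔
          t ^ 2 ≤ 1 - ∑ j, y j ^ 2 := by
        rw [Set.mem_Icc, ← abs_le, ← sq_abs, Real.le_sqrt (abs_nonneg t) hc]
      by_cases h : t ^ 2 ≤ 1 - ∑ j, y j ^ 2
      · rw [Set.indicator_of_mem (hmem.2 h), Set.indicator_of_mem (hmem2.2 h), hsum, hρ]
        simp only [map_sub, map_mul, eval_rhoPoly, eval_X, hsum, hρ, Fin.insertNth_apply_same]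
      · rw [Set.indicator_of_notMem (mt hmem.1 h), Set.indicator_of_notMem (mt hmem2.1 h)]
    · exact Set.indicator_of_notMem (fun h => hc ((sq_nonneg t).trans (hmem.1 h))) _
  have key := integral_prod_symm _ hI2
  refine key.trans (integral_eq_zero_of_ae ?_)
  filter_upwards [hI2.prod_left_ae] with y hy
  simp only [Function.comp_def, hslice] at hy ⊢
  by_cases hc : 0 ≤ 1 - ∑ j, y j ^ 2
  · simp only [if_pos hc] at hy ⊢
    rw [integral_indicator measurableSet_Icc]
    exact integral_slice_eq_zero (hasDerivAt_eval_insertNth i y q) hy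
  · simp only [if_neg hc, integral_zero, Pi.zero_apply]

end IntegrationByParts

section Localization

theorem exists_polynomial_le_rpow (e : ℝ) {r s : ℝ} (hr : 0 < r) (hrs : r ≤ s) (hs : s < 1)
    {ε : ℝ} (hε : 0 < ε) :
    ∃ f : Polynomial ℝ, f.eval 0 = 0 ∧ f.eval 1 = 0 ∧
      (∀ t, 0 < t → t ≤ 1 → 0 ≤ f.eval t ∧ f.eval t ≤ t ^ e) ∧
      ∀ t ∈ Set.Icc r s, (1 - ε) * t ^ e ≤ f.eval t := by
  obtain ⟨j, hj⟩ := exists_nat_ge (max e 1)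
  have hj1 : (1 : ℝ) ≤ j := (le_max_right _ _).trans hj
  have he : e - j ≤ 0 := sub_nonpos.2 ((le_max_left _ _).trans hj)
  obtain ⟨m, hm⟩ := exists_pow_lt_of_lt_one (half_pos hε) hs
  set η := min (ε / 4) (1 / 4)
  have hη : 0 < η := by positivity
  have hη1 : η ≤ ε / 4 := min_le_left _ _
  have hη2 : η ≤ 1 / 4 := min_le_right _ _
  have hcont : Continuous fun t : ℝ => (1 - η) * max t r ^ (e - j) :=
    continuous_const.mul ((continuous_id.max continuous_const).rpow_const fun t =>
      Or.inl (hr.trans_le (le_max_right t r)).ne')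
  obtain ⟨q, hq⟩ := exists_polynomial_near_of_continuousOn 0 1 _ hcont.continuousOn η hη
  have hM : ∀ t, t ≤ 1 → 1 ≤ max t r ^ (e - j) := fun t ht =>
    Real.one_le_rpow_of_pos_of_le_one_of_nonpos (hr.trans_le (le_max_right t r))
      (max_le ht (hrs.trans hs.le)) he
  have hsplit : ∀ t : ℝ, 0 < t → t ^ e = t ^ j * t ^ (e - j) := fun t ht => by
    rw [← Real.rpow_natCast, ← Real.rpow_add ht]
    congr 1
    ring
  have hql : ∀ t, 0 < t → t ≤ 1 → (1 - 2 * η) * max t r ^ (e - j) ≤ q.eval t := fun t h0 h1 => by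
    have h2 := (abs_lt.1 (hq t ⟨h0.le, h1⟩)).1
    nlinarith [hM t h1]
  refine ⟨Polynomial.X ^ j * q * (1 - Polynomial.X ^ m), ?_, by simp, fun t h0 h1 => ?_,
    fun t ht => ?_⟩
  · have : j ≠ 0 := by
      rintro rfl
      norm_num at hj1
    simp [this]
  · have h2 := (abs_lt.1 (hq t ⟨h0.le, h1⟩)).2
    have h3 := hM t h1
    have h4 : max t r ^ (e - j) ≤ t ^ (e - j) :=
      Real.rpow_le_rpow_of_nonpos h0 (le_max_left t r) he
    have h5 : 0 ≤ q.eval t := le_trans (by nlinarith) (hql t h0 h1)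
    have h6 : q.eval t ≤ t ^ (e - j) := by nlinarith
    have h7 : t ^ m ≤ 1 := pow_le_one₀ h0.le h1
    have h8 : 0 ≤ t ^ m := by positivity
    have h9 : 0 ≤ t ^ j := by positivity
    simp only [Polynomial.eval_mul, Polynomial.eval_pow, Polynomial.eval_X, Polynomial.eval_sub,
      Polynomial.eval_one]
    refine ⟨mul_nonneg (mul_nonneg h9 h5) (by linarith), ?_⟩
    rw [hsplit t h0]
    refine (mul_le_of_le_one_right (mul_nonneg h9 h5) (by linarith)).trans ?_
    exact mul_le_mul_of_nonneg_left h6 h9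
  · have h0 : 0 < t := hr.trans_le ht.1
    have h1 : t ≤ 1 := ht.2.trans hs.le
    have h2 := hql t h0 h1
    rw [max_eq_left ht.1] at h2
    have h3 : t ^ m ≤ ε / 2 := (pow_le_pow_left₀ h0.le ht.2 m).trans hm.le
    have h4 : 0 ≤ t ^ m := by positivity
    have h7 : t ^ m ≤ 1 := pow_le_one₀ h0.le h1
    have h5 : 0 < t ^ j := by positivity
    have h6 : 0 < t ^ (e - j) := by positivity
    simp only [Polynomial.eval_mul, Polynomial.eval_pow, Polynomial.eval_X, Polynomial.eval_sub,
      Polynomial.eval_one]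
    rw [hsplit t h0]
    calc (1 - ε) * (t ^ j * t ^ (e - j))
        ≤ (1 - 2 * η) * (1 - t ^ m) * (t ^ j * t ^ (e - j)) := by
          refine mul_le_mul_of_nonneg_right ?_ (mul_pos h5 h6).le
          nlinarith
      _ = t ^ j * ((1 - 2 * η) * t ^ (e - j)) * (1 - t ^ m) := by ring
      _ ≤ t ^ j * q.eval t * (1 - t ^ m) :=
          mul_le_mul_of_nonneg_right (mul_le_mul_of_nonneg_left h2 h5.le) (by linarith)

variable {d : ℕ}

/-- The closed spherical shell of points with `1 - ‖x‖² ∈ [r, s]`. -/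
def shell (d : ℕ) (r s : ℝ) : Set (Fin d → ℝ) := {x | 1 - ∑ i, x i ^ 2 ∈ Set.Icc r s}

theorem exists_localizing_polynomial (a b : ℝ) {r s : ℝ} (hr : 0 < r) (hrs : r ≤ s) (hs : s < 1)
    {ε : ℝ} (hε : 0 < ε) :
    ∃ g : MvPolynomial (Fin d) ℝ, eval 0 g = 0 ∧
      (∀ x ∈ ballSet d, eval x g ^ 2 * (1 - ∑ i, x i ^ 2) ^ a ≤ (1 - ∑ i, x i ^ 2) ^ b) ∧
      ∀ x ∈ shell d r s, (1 - ε) * (1 - ∑ i, x i ^ 2) ^ (b - a) ≤ eval x g ^ 2 := by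
  obtain ⟨f, hf0, hf1, hf, hfl⟩ := exists_polynomial_le_rpow ((b - a) / 2) hr hrs hs
    (ε := min (ε / 2) 1) (by positivity)
  have heval : ∀ x : Fin d → ℝ, eval x (Polynomial.aeval (rhoPoly d) f) =
      f.eval (1 - ∑ i, x i ^ 2) := fun x => by
    rw [← eval_rhoPoly, Polynomial.aeval_def, Polynomial.hom_eval₂, Polynomial.eval]
    congr 1
    ext
    simp
  have hsq : ∀ t : ℝ, 0 < t → (t ^ ((b - a) / 2)) ^ 2 = t ^ (b - a) := fun t ht => by
    rw [← Real.rpow_natCast, ← Real.rpow_mul ht.le]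
    congr 1
    push_cast
    ring
  refine ⟨Polynomial.aeval (rhoPoly d) f, ?_, fun x hx => ?_, fun x hx => ?_⟩
  · rw [heval]
    simp [hf1]
  · rw [heval]
    have h1 : 1 - ∑ i, x i ^ 2 ≤ 1 := sub_le_self _ (Finset.sum_nonneg fun i _ => sq_nonneg _)
    rcases (sub_nonneg.2 hx : 0 ≤ 1 - ∑ i, x i ^ 2).eq_or_lt with h | h
    · rw [← h, hf0]
      simpa using Real.zero_rpow_nonneg b
    · obtain ⟨h2, h3⟩ := hf _ h h1
      calc f.eval (1 - ∑ i, x i ^ 2) ^ 2 * (1 - ∑ i, x i ^ 2) ^ a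
          ≤ ((1 - ∑ i, x i ^ 2) ^ ((b - a) / 2)) ^ 2 * (1 - ∑ i, x i ^ 2) ^ a := by gcongr
        _ = (1 - ∑ i, x i ^ 2) ^ b := by
          rw [hsq _ h, ← Real.rpow_add h, sub_add_cancel]
  · rw [heval]
    have h0 : 0 < 1 - ∑ i, x i ^ 2 := hr.trans_le hx.1
    have h1 := hfl _ hx
    have h2 : min (ε / 2) 1 ≤ ε / 2 := min_le_left _ _
    have h3 : min (ε / 2) 1 ≤ 1 := min_le_right _ _
    rw [← hsq _ h0]
    refine le_trans ?_ (pow_le_pow_left₀ (mul_nonneg (by linarith) (by positivity)) h1 2)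
    rw [mul_pow]
    refine mul_le_mul_of_nonneg_right ?_ (sq_nonneg _)
    nlinarith [sq_nonneg (min (ε / 2) 1)]

theorem exists_localized_diagKernel_le (hd : 0 < d) {a b : ℝ} (ha : -1 / 2 ≤ a)
    (hb : -1 / 2 ≤ b) {F G : MvPolynomial (Fin d) ℝ →ₗ[ℝ] ℝ} (hF : IsPosDefFunctional F)
    (hG : IsPosDefFunctional G) {cF cG : ℝ} (hcG : 0 ≤ cG)
    (hFw : ∀ p, weightFunctional hd hb (p * p) ≤ cF * F (p * p))
    (hGw : ∀ p, eval 0 p = 0 → G (p * p) ≤ cG * weightFunctional hd ha (p * p))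
    {r s : ℝ} (hr : 0 < r) (hrs : r ≤ s) (hs : s < 1) {ε : ℝ} (hε : 0 < ε) :
    ∃ D : ℕ, ∀ n, ∀ x ∈ shell d r s,
      (1 - ε) * (1 - ∑ i, x i ^ 2) ^ (b - a) * diagKernel F n x ≤
        cF * cG * diagKernel G (n + D) x := by
  obtain ⟨g, hg0, hgle, hgl⟩ := exists_localizing_polynomial (d := d) a b hr hrs hs hε
  refine ⟨g.totalDegree, fun n x hx => ?_⟩
  refine (mul_le_mul_of_nonneg_right (hgl x hx) (hF.diagKernel_pos n x).le).trans ?_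
  refine hF.diagKernel_le_mul hG le_rfl le_rfl (fun p => ?_) x
  calc G (g * p * (g * p)) ≤ cG * weightFunctional hd ha (g * p * (g * p)) :=
        hGw _ (by rw [map_mul, hg0, zero_mul])
    _ ≤ cG * weightFunctional hd hb (p * p) :=
        mul_le_mul_of_nonneg_left (weightFunctional_mul_self_le hd ha hb hgle p) hcG
    _ ≤ cG * (cF * F (p * p)) := mul_le_mul_of_nonneg_left (hFw p) hcG
    _ = cF * cG * F (p * p) := by ring

end Localization

section Asymptotics

theorem tendsto_choose_div_choose (d D : ℕ) :
    Filter.Tendsto (fun n : ℕ => ((n + D + d).choose d : ℝ) / ((n + d).choose d : ℝ))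
      Filter.atTop (nhds 1) := by
  have hpos : ∀ n : ℕ, (0 : ℝ) < ((n + d).choose d : ℝ) := fun n => by
    exact_mod_cast Nat.choose_pos (Nat.le_add_left d n)
  have hstep : Filter.Tendsto
      (fun n : ℕ => ((n + 1 + d).choose d : ℝ) / ((n + d).choose d : ℝ)) Filter.atTop (nhds 1) := by
    have h : ∀ n : ℕ, ((n + 1 + d).choose d : ℝ) / ((n + d).choose d : ℝ) =
        1 + d * (1 / ((n : ℝ) + 1)) := fun n => by
      have h1 := Nat.choose_mul_succ_eq (n + d) d
      rw [show n + d + 1 - d = n + 1 by omega, show n + d + 1 = n + 1 + d by ring] at h1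
      have h2 : ((n + d).choose d : ℝ) * ((n : ℝ) + 1 + d) =
          ((n + 1 + d).choose d : ℝ) * ((n : ℝ) + 1) := by exact_mod_cast h1
      have := hpos n
      field_simp
      linarith
    simp only [h]
    simpa using (tendsto_one_div_add_atTop_nhds_zero_nat (𝕜 := ℝ)).const_mul (d : ℝ) |>.const_add 1
  induction D with
  | zero => simpa using tendsto_const_nhds.congr fun n => (div_self (hpos n).ne').symm
  | succ D ih =>
    have h := (hstep.comp (Filter.tendsto_add_atTop_nat D)).mul ih
    rw [mul_one] at h
    refine h.congr fun n => ?_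
    have := hpos (n + D)
    have := hpos n
    simp only [Function.comp_apply]
    rw [show n + D + 1 + d = n + (D + 1) + d by ring]
    field_simp

theorem tendstoUniformlyOn_div_of_shift_le {X : Type*} {S : Set X} {κ : ℕ → X → ℝ} {N : ℕ → ℝ}
    {L : X → ℝ} {M : ℝ} (hN : ∀ n, 0 < N n)
    (hratio : ∀ D, Filter.Tendsto (fun n => N (n + D) / N n) Filter.atTop (nhds 1))
    (hL : ∀ x ∈ S, 0 ≤ L x) (hM : ∀ x ∈ S, L x ≤ M)
    (hlow : ∀ ε > 0, ε ≤ 1 → ∃ D, ∀ n, ∀ x ∈ S, (1 - ε) * (L x * N n) ≤ κ (n + D) x)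
    (hup : ∀ ε > 0, ε ≤ 1 → ∃ D, ∀ n, ∀ x ∈ S, (1 - ε) * κ n x ≤ L x * N (n + D)) :
    TendstoUniformlyOn (fun n x => κ n x / N n) L Filter.atTop S := by
  rw [Metric.tendstoUniformlyOn_iff]
  intro η hη
  set ε := min (1 / 2) (η / (4 * (|M| + 1)))
  have hε : 0 < ε := by positivity
  have hε2 : ε ≤ 1 / 2 := min_le_left _ _
  have hεη : 4 * (|M| + 1) * ε ≤ η := by
    have h : ε ≤ η / (4 * (|M| + 1)) := min_le_right _ _
    rw [le_div_iff₀ (by positivity)] at h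
    linarith
  have hbound : ∀ x ∈ S, 4 * ε * L x < η := fun x hx => by
    have := (hM x hx).trans (le_abs_self M)
    nlinarith
  obtain ⟨D₁, hD₁⟩ := hlow ε hε (by linarith)
  obtain ⟨D₂, hD₂⟩ := hup ε hε (by linarith)
  have he1 : ∀ᶠ n in Filter.atTop, ∀ x ∈ S, L x - κ n x / N n < η := by
    have h1 := (hratio D₁).eventually (gt_mem_nhds (show (1 : ℝ) < 1 + ε by linarith))
    obtain ⟨n₀, hn₀⟩ := Filter.eventually_atTop.1 h1
    filter_upwards [Filter.eventually_ge_atTop (n₀ + D₁)] with n hn x hx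
    obtain ⟨m, rfl⟩ : ∃ m, n = m + D₁ := ⟨n - D₁, by omega⟩
    have h2 := hD₁ m x hx
    have h3 := hbound x hx
    have h4 := hL x hx
    have h5 := hN m
    have h6 := hN (m + D₁)
    have h7 : (1 - ε) * N (m + D₁) ≤ N m := by
      have h8 := hn₀ m (by omega)
      rw [div_lt_iff₀ h5] at h8
      have h9 := mul_le_mul_of_nonneg_left h8.le (show 0 ≤ 1 - ε by linarith)
      have h10 : 0 ≤ ε ^ 2 * N m := by positivity
      linarith
    have h8 : L x * ((1 - ε) * N (m + D₁)) ≤ L x * N m := mul_le_mul_of_nonneg_left h7 h4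
    have h9 : (1 - ε) * (L x * ((1 - ε) * N (m + D₁))) ≤ κ (m + D₁) x :=
      (mul_le_mul_of_nonneg_left h8 (by linarith)).trans h2
    have h10 : (1 - ε) * (L x * (1 - ε)) ≤ κ (m + D₁) x / N (m + D₁) := by
      rw [le_div_iff₀ h6]
      linarith
    have h11 : 0 ≤ L x * ε ^ 2 := by positivity
    nlinarith
  have he2 : ∀ᶠ n in Filter.atTop, ∀ x ∈ S, κ n x / N n - L x < η := by
    filter_upwards [(hratio D₂).eventually (gt_mem_nhds (show (1 : ℝ) < 1 + ε by linarith))]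
      with n hn x hx
    have h2 := hD₂ n x hx
    have h3 := hbound x hx
    have h4 := hL x hx
    have h5 := hN n
    have h6 : (1 - ε) * (κ n x / N n) ≤ L x * (N (n + D₂) / N n) := by
      rw [← mul_div_assoc, ← mul_div_assoc]
      gcongr
    have h7 : L x * (N (n + D₂) / N n) ≤ L x * (1 + ε) := by gcongr
    have h8 : (1 - ε) * (κ n x / N n - L x) ≤ 2 * ε * L x := by linarith
    by_contra! h9
    nlinarith
  filter_upwards [he1, he2] with n h1 h2 x hx
  rw [Real.dist_eq, abs_lt]
  constructor <;> linarith [h1 x hx, h2 x hx]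

theorem omegaMu_pos {d : ℕ} {μ : ℝ} (hμ : 0 ≤ μ) : 0 < omegaMu d μ := by
  have h1 := Real.Gamma_pos_of_pos (s := μ + ((d : ℝ) + 1) / 2) (by positivity)
  have h2 := Real.Gamma_pos_of_pos (s := μ + 1 / 2) (by positivity)
  have h3 := Real.pi_pos
  rw [omegaMu]
  positivity

theorem weightFunctional_one {d : ℕ} (hd : 0 < d) :
    weightFunctional hd (a := -1 / 2) le_rfl 1 = (omegaMu d 0)⁻¹ := by
  rw [weightFunctional_apply]
  simp only [map_one, one_mul]
  exact eq_inv_of_mul_eq_one_right (integral_chebyshev hd)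

/-- Matching asymptotic bounds for the Christoffel kernel of the weight `(1 - ‖x‖²)^{-1/2}`. -/
theorem exists_chebyshev_bounds {d : ℕ} (hd : 0 < d) {r s : ℝ} (hr : 0 < r) (hrs : r ≤ s)
    (hs : s < 1) {ε : ℝ} (hε : 0 < ε) (hε1 : ε ≤ 1) :
    ∃ D : ℕ, ∀ n, ∀ x ∈ shell d r s,
      (1 - ε) * (omegaMu d 0 * ((n + d).choose d : ℝ)) ≤
        diagKernel (weightFunctional hd (a := -1 / 2) le_rfl) (n + D) x ∧
      (1 - ε) * diagKernel (weightFunctional hd (a := -1 / 2) le_rfl) n x ≤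
        omegaMu d 0 * ((n + D + d).choose d : ℝ) := by
  set F := weightFunctional hd (a := -1 / 2) le_rfl
  set G := weightFunctional hd (a := 1 / 2) (by norm_num)
  have hF : IsPosDefFunctional F := isPosDefFunctional_weightFunctional hd _
  have hG : IsPosDefFunctional G := isPosDefFunctional_weightFunctional hd _
  obtain ⟨D₁, hD₁⟩ := exists_localized_diagKernel_le hd (a := -1 / 2) (b := 1 / 2) le_rfl
    (by norm_num) hG hF (cF := 1) (cG := 1) zero_le_one (fun p => (one_mul _).ge)
    (fun p _ => (one_mul _).ge) hr hrs hs hε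
  obtain ⟨D₂, hD₂⟩ := exists_localized_diagKernel_le hd (a := 1 / 2) (b := -1 / 2) (by norm_num)
    le_rfl hF hG (cF := 1) (cG := 1) zero_le_one (fun p => (one_mul _).ge)
    (fun p _ => (one_mul _).ge) hr hrs hs hε
  have hω := omegaMu_pos (d := d) le_rfl
  have hident : ∀ (n : ℕ) (x : Fin d → ℝ), diagKernel F (n + 1) x +
      (1 - ∑ i, x i ^ 2) * diagKernel G n x =
        omegaMu d 0 * (((n + 1 + d).choose d : ℝ) + ((n + d).choose d : ℝ)) := fun n x => by
    have hρG : rhoMul F = G := rhoMul_weightFunctional hd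
    have hF1 : F 1 = (omegaMu d 0)⁻¹ := weightFunctional_one hd
    have h := diagKernel_add_rhoMul_diagKernel hF (hρG ▸ hG)
      (weightFunctional_integration_by_parts hd) n x
    rw [hρG, hF1, div_inv_eq_mul] at h
    linarith
  have hchoose : ∀ {m n : ℕ}, m ≤ n → ((m + d).choose d : ℝ) ≤ ((n + d).choose d : ℝ) :=
    fun h => by exact_mod_cast Nat.choose_le_choose d (by omega)
  refine ⟨D₁ + D₂ + 1, fun n x hx => ?_⟩
  have hρ : 0 < 1 - ∑ i, x i ^ 2 := hr.trans_le hx.1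
  have hmono := hF.diagKernel_mono x
  constructor
  · have h1 := hD₁ n x hx
    norm_num at h1
    have h2 := hident n x
    have h3 : diagKernel F (n + D₁) x ≤ diagKernel F (n + (D₁ + D₂ + 1)) x :=
      hmono (by omega)
    have h4 : diagKernel F (n + 1) x ≤ diagKernel F (n + (D₁ + D₂ + 1)) x := hmono (by omega)
    have h5 := mul_le_mul_of_nonneg_left (hchoose (Nat.le_succ n)) hω.le
    have h6 := hF.diagKernel_pos (n + 1) x
    nlinarith
  · have h1 := hD₂ n x hx
    norm_num at h1
    have h2 := hident (n + D₂) x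
    have h3 : diagKernel F n x ≤ diagKernel F (n + D₂ + 1) x := hmono (by omega)
    have h4 := mul_le_mul_of_nonneg_left
      (hchoose (show n + D₂ + 1 ≤ n + (D₁ + D₂ + 1) by omega)) hω.le
    have h5 := mul_le_mul_of_nonneg_left
      (hchoose (show n + D₂ ≤ n + (D₁ + D₂ + 1) by omega)) hω.le
    have h6 := hF.diagKernel_pos n x
    have h7 : (1 - ε) * diagKernel F n x ≤
        (1 - ∑ i, x i ^ 2) * diagKernel G (n + D₂) x := by
      rw [Real.rpow_neg_one] at h1
      have h8 := mul_le_mul_of_nonneg_left h1 hρ.le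
      field_simp at h8
      linarith
    nlinarith

theorem exists_subset_shell {d : ℕ} {K : Set (Fin d → ℝ)} (hK : IsCompact K)
    (hsub : K ⊆ {x | 0 < Real.sqrt (∑ i, x i ^ 2) ∧ Real.sqrt (∑ i, x i ^ 2) < 1}) :
    ∃ r s : ℝ, 0 < r ∧ r ≤ s ∧ s < 1 ∧ K ⊆ shell d r s := by
  rcases K.eq_empty_or_nonempty with rfl | hne
  · exact ⟨1 / 2, 1 / 2, by norm_num, le_rfl, by norm_num, Set.empty_subset _⟩
  have hcont : ContinuousOn (fun x : Fin d → ℝ => 1 - ∑ i, x i ^ 2) K := by fun_prop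
  obtain ⟨y, hy, hymin⟩ := hK.exists_isMinOn hne hcont
  obtain ⟨z, hz, hzmax⟩ := hK.exists_isMaxOn hne hcont
  have hy1 := (Real.sqrt_lt' one_pos).1 (hsub hy).2
  have hz0 := Real.sqrt_pos.1 (hsub hz).1
  exact ⟨_, _, by linarith, hymin hz, by linarith, fun x hx => ⟨hymin hx, hzmax hx⟩⟩

section Uvarov

variable {d : ℕ} {μ lam : ℝ} {u v : MvPolynomial (Fin d) ℝ →ₗ[ℝ] ℝ}

theorem uvarov_apply_mul_self (hd : 0 < d) (hμ : -1 / 2 ≤ μ - 1 / 2) (hu : IsBallFunctional d μ u)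
    (hv : ∀ p : MvPolynomial (Fin d) ℝ, v p = u p + lam * eval 0 p)
    (p : MvPolynomial (Fin d) ℝ) :
    v (p * p) = omegaMu d μ * weightFunctional hd hμ (p * p) + lam * eval 0 p ^ 2 := by
  rw [hv, hu, weightFunctional_apply, map_mul, sq]

theorem isPosDefFunctional_uvarov (hd : 0 < d) (hμ : 0 ≤ μ) (hlam : 0 < lam)
    (hu : IsBallFunctional d μ u)
    (hv : ∀ p : MvPolynomial (Fin d) ℝ, v p = u p + lam * eval 0 p) : IsPosDefFunctional v := by
  have ha : -1 / 2 ≤ μ - 1 / 2 := by linarith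
  intro p hp
  have h1 := mul_pos (omegaMu_pos (d := d) hμ) (isPosDefFunctional_weightFunctional hd ha p hp)
  rw [uvarov_apply_mul_self hd ha hu hv]
  positivity

theorem exists_uvarov_bounds (hd : 0 < d) (hμ : 0 ≤ μ) (hlam : 0 < lam)
    (hu : IsBallFunctional d μ u)
    (hv : ∀ p : MvPolynomial (Fin d) ℝ, v p = u p + lam * eval 0 p)
    {r s : ℝ} (hr : 0 < r) (hrs : r ≤ s) (hs : s < 1) {ε : ℝ} (hε : 0 < ε) (hε1 : ε ≤ 1) :
    ∃ D : ℕ, ∀ n, ∀ x ∈ shell d r s,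
      (1 - ε) * (omegaMu d 0 / omegaMu d μ * (1 - ∑ i, x i ^ 2) ^ (-μ) *
        ((n + d).choose d : ℝ)) ≤ diagKernel v (n + D) x ∧
      (1 - ε) * diagKernel v n x ≤
        omegaMu d 0 / omegaMu d μ * (1 - ∑ i, x i ^ 2) ^ (-μ) *
          ((n + D + d).choose d : ℝ) := by
  have ha : -1 / 2 ≤ μ - 1 / 2 := by linarith
  have hω := omegaMu_pos (d := d) hμ
  have hvpd := isPosDefFunctional_uvarov hd hμ hlam hu hv
  have hpd := isPosDefFunctional_weightFunctional hd (a := -1 / 2) le_rfl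
  obtain ⟨D₁, hD₁⟩ := exists_localized_diagKernel_le hd ha (b := -1 / 2) le_rfl hpd hvpd
    (cF := 1) (cG := omegaMu d μ) hω.le (fun p => (one_mul _).ge)
    (fun p hp => by rw [uvarov_apply_mul_self hd ha hu hv, hp]; simp) hr hrs hs (half_pos hε)
  obtain ⟨D₂, hD₂⟩ := exists_localized_diagKernel_le hd (a := -1 / 2) le_rfl ha hvpd hpd
    (cF := (omegaMu d μ)⁻¹) (cG := 1) zero_le_one
    (fun p => by
      rw [uvarov_apply_mul_self hd ha hu hv, mul_add, inv_mul_cancel_left₀ hω.ne']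
      exact le_add_of_nonneg_right (by positivity))
    (fun p _ => (one_mul _).ge) hr hrs hs (half_pos hε)
  obtain ⟨D₀, hD₀⟩ := exists_chebyshev_bounds hd hr hrs hs (half_pos hε) (by linarith)
  refine ⟨D₀ + D₁ + D₂, fun n x hx => ?_⟩
  have hρ : 0 < 1 - ∑ i, x i ^ 2 := hr.trans_le hx.1
  have hρμ : 0 < (1 - ∑ i, x i ^ 2) ^ μ := Real.rpow_pos_of_pos hρ _
  have hα := omegaMu_pos (d := d) le_rfl
  have hε2 : 0 ≤ 1 - ε / 2 := by linarith
  have hsq : 1 - ε ≤ (1 - ε / 2) * (1 - ε / 2) := by nlinarith [sq_nonneg ε]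
  rw [Real.rpow_neg hρ.le]
  constructor
  · have h1 := hD₁ (n + D₀) x hx
    rw [show -1 / 2 - (μ - 1 / 2) = -μ by ring, Real.rpow_neg hρ.le, one_mul] at h1
    have h2 := mul_le_mul_of_nonneg_left (hD₀ n x hx).1
      (mul_nonneg hε2 (inv_pos.2 hρμ).le)
    have h3 : diagKernel v (n + D₀ + D₁) x ≤ diagKernel v (n + (D₀ + D₁ + D₂)) x :=
      hvpd.diagKernel_mono x (by omega)
    refine le_trans ?_ h3
    rw [← mul_le_mul_iff_right₀ hω]
    refine le_trans ?_ (h2.trans h1)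
    calc omegaMu d μ * ((1 - ε) * (omegaMu d 0 / omegaMu d μ * ((1 - ∑ i, x i ^ 2) ^ μ)⁻¹ *
          ((n + d).choose d : ℝ)))
        = (1 - ε) * (((1 - ∑ i, x i ^ 2) ^ μ)⁻¹ * (omegaMu d 0 * ((n + d).choose d : ℝ))) := by
          field_simp
      _ ≤ (1 - ε / 2) * (1 - ε / 2) *
            (((1 - ∑ i, x i ^ 2) ^ μ)⁻¹ * (omegaMu d 0 * ((n + d).choose d : ℝ))) := by gcongr
      _ = _ := by ring
  · have h1 := hD₂ n x hx
    rw [show μ - 1 / 2 - -1 / 2 = μ by ring, mul_one] at h1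
    have h2 := (hD₀ (n + D₂) x hx).2
    have h3 : ((n + D₂ + D₀ + d).choose d : ℝ) ≤ ((n + (D₀ + D₁ + D₂) + d).choose d : ℝ) := by
      exact_mod_cast Nat.choose_le_choose d (by omega)
    have hκ := hvpd.diagKernel_pos n x
    calc (1 - ε) * diagKernel v n x
        ≤ (1 - ε / 2) * (1 - ε / 2) * diagKernel v n x := by gcongr
      _ = ((1 - ∑ i, x i ^ 2) ^ μ)⁻¹ * ((1 - ε / 2) *
            ((1 - ε / 2) * (1 - ∑ i, x i ^ 2) ^ μ * diagKernel v n x)) := by field_simp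
      _ ≤ ((1 - ∑ i, x i ^ 2) ^ μ)⁻¹ * ((1 - ε / 2) * ((omegaMu d μ)⁻¹ *
            diagKernel (weightFunctional hd (a := -1 / 2) le_rfl) (n + D₂) x)) := by gcongr
      _ = ((1 - ∑ i, x i ^ 2) ^ μ)⁻¹ * ((omegaMu d μ)⁻¹ * ((1 - ε / 2) *
            diagKernel (weightFunctional hd (a := -1 / 2) le_rfl) (n + D₂) x)) := by ring
      _ ≤ ((1 - ∑ i, x i ^ 2) ^ μ)⁻¹ * ((omegaMu d μ)⁻¹ *
            (omegaMu d 0 * ((n + (D₀ + D₁ + D₂) + d).choose d : ℝ))) :=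
          mul_le_mul_of_nonneg_left (mul_le_mul_of_nonneg_left
            (h2.trans (mul_le_mul_of_nonneg_left h3 hα.le)) (inv_pos.2 hω).le) (inv_pos.2 hρμ).le
      _ = _ := by ring

end Uvarov

theorem omegaMu_zero_div_omegaMu {d : ℕ} {μ : ℝ} (hμ : 0 ≤ μ) :
    omegaMu d 0 / omegaMu d μ = 1 / Real.sqrt Real.pi *
      (Real.Gamma (μ + 1 / 2) * Real.Gamma (((d : ℝ) + 1) / 2) /
        Real.Gamma (μ + ((d : ℝ) + 1) / 2)) := by
  have h1 := Real.Gamma_pos_of_pos (s := μ + ((d : ℝ) + 1) / 2) (by positivity)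
  have h2 := Real.Gamma_pos_of_pos (s := μ + 1 / 2) (by positivity)
  have h3 := Real.sqrt_pos.2 Real.pi_pos
  have h4 := Real.rpow_pos_of_pos Real.pi_pos ((d : ℝ) / 2)
  rw [omegaMu, omegaMu, zero_add, zero_add, Real.Gamma_one_half_eq]
  field_simp

end Asymptotics

/-- Theorem 5.3, asymptotics.  For the Uvarov modification
`v = u_μ + λδ_0` (`μ ≥ 0`, `λ > 0`), uniformly on compact subsets of
`{x : 0 < ‖x‖ < 1}`,
`K_n(v;x,x)/C(n+d,d) → (1/√π)(Γ(μ+1/2)Γ((d+1)/2)/Γ(μ+(d+1)/2))(1-‖x‖²)^{-μ}`. -/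
theorem ball_uvarov_christoffel_asymptotics
    {d : ℕ} (hd : 2 ≤ d) {μ : ℝ} (hμ : 0 ≤ μ) {lam : ℝ} (hlam : 0 < lam)
    (u v : MvPolynomial (Fin d) ℝ →ₗ[ℝ] ℝ)
    (hu : IsBallFunctional d μ u)
    (hv : ∀ p : MvPolynomial (Fin d) ℝ, v p = u p + lam * eval 0 p)
    (Q : PolySystem d) (hQ : IsOPS v Q) :
    ∀ K : Set (Fin d → ℝ), IsCompact K →
      K ⊆ {x | 0 < Real.sqrt (∑ i, x i ^ 2) ∧ Real.sqrt (∑ i, x i ^ 2) < 1} →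
      TendstoUniformlyOn
        (fun (n : ℕ) (x : Fin d → ℝ) =>
          kerLT v Q (n + 1) x x / (Nat.choose (n + d) d : ℝ))
        (fun x : Fin d → ℝ =>
          (1 / Real.sqrt Real.pi) *
            (Real.Gamma (μ + 1 / 2) * Real.Gamma (((d : ℝ) + 1) / 2) /
              Real.Gamma (μ + ((d : ℝ) + 1) / 2)) *
            (1 - ∑ i, x i ^ 2) ^ (-μ))
        Filter.atTop K := by
  intro K hK hsub
  have hd' : 0 < d := by omega
  obtain ⟨r, s, hr, hrs, hs, hKs⟩ := exists_subset_shell hK hsub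
  have hvpd := isPosDefFunctional_uvarov hd' hμ hlam hu hv
  have hquot : 0 < omegaMu d 0 / omegaMu d μ :=
    div_pos (omegaMu_pos le_rfl) (omegaMu_pos hμ)
  simp only [hQ.kerLT_eq_diagKernel hvpd, ← omegaMu_zero_div_omegaMu hμ]
  refine TendstoUniformlyOn.mono ?_ hKs
  refine tendstoUniformlyOn_div_of_shift_le (κ := fun n x => diagKernel v n x)
    (N := fun n => ((n + d).choose d : ℝ)) (M := omegaMu d 0 / omegaMu d μ * r ^ (-μ))
    (fun n => by exact_mod_cast Nat.choose_pos (Nat.le_add_left d n))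
    (tendsto_choose_div_choose d) (fun x hx => ?_) (fun x hx => ?_)
    (fun ε hε hε1 => ?_) (fun ε hε hε1 => ?_)
  · exact mul_nonneg hquot.le (Real.rpow_nonneg (hr.le.trans hx.1) _)
  · exact mul_le_mul_of_nonneg_left
      (Real.rpow_le_rpow_of_nonpos hr hx.1 (neg_nonpos.2 hμ)) hquot.le
  · obtain ⟨D, hD⟩ := exists_uvarov_bounds hd' hμ hlam hu hv hr hrs hs hε hε1
    exact ⟨D, fun n x hx => (hD n x hx).1⟩
  · obtain ⟨D, hD⟩ := exists_uvarov_bounds hd' hμ hlam hu hv hr hrs hs hε hε1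
    exact ⟨D, fun n x hx => (hD n x hx).2⟩
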